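/- For the specification of Poole's Example 6, the arguments ⟨A1,g1⟩ and ⟨A2,g2⟩ satisfy ⟨A1,g1⟩ ≈CP ⟨A2,g2⟩ (each is ≲CP the other), whereas under ≲P3 they are incomparable: neither ⟨A1,g1⟩ ≲P3 ⟨A2,g2⟩ nor ⟨A2,g2⟩ ≲P3 ⟨A1,g1⟩. -/

import Mathlib

/-- A literal: an atom, possibly prefixed with negation. -/
inductive Lit (α : Type) : Type where
  | pos : α → Lit α
  | neg : α → Lit α
  deriving DecidableEq

/-- A (ground) rule: a head literal together with a finite (possibly empty)
conjunction of body literals.  A rule with empty body is just a literal. -/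
structure Rule (α : Type) : Type where
  head : Lit α
  body : Finset (Lit α)
  deriving DecidableEq

/-- View a set of literals as a set of bodiless rules. -/
def litRules {α : Type} (S : Set (Lit α)) : Set (Rule α) :=
  {r | r.head ∈ S ∧ r.body = ∅}

/-- The theory `𝔗_P` of a set of rules `P`: the least set of literals
containing the bodiless rules of `P` and closed under the rules of `P`. -/
inductive Th {α : Type} (P : Set (Rule α)) : Lit α → Prop where
  | step (r : Rule α) (hr : r ∈ P) (ih : ∀ l ∈ r.body, Th P l) : Th P r.head

/-- A set of rules is contradictory iff it derives both `A` and `¬A`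
for some atom `A`. -/
def Contradictory {α : Type} (P : Set (Rule α)) : Prop :=
  ∃ a : α, Th P (Lit.pos a) ∧ Th P (Lit.neg a)

/-- A defeasible specification `⟨Π^F, Π^G, Δ⟩`:
facts, general (strict) rules, and defeasible rules (all taken ground). -/
structure Spec (α : Type) : Type where
  F : Set (Lit α)
  G : Set (Rule α)
  D : Set (Rule α)

namespace Spec

variable {α : Type}

/-- `Π := Π^F ∪ Π^G`. -/
def strict (S : Spec α) : Set (Rule α) := litRules S.F ∪ S.G

/-- `𝔗_Π`. -/
def ThStrict (S : Spec α) : Set (Lit α) := {l | Th S.strict l}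

/-- `𝔗_{Π ∪ Δ}`. -/
def ThAll (S : Spec α) : Set (Lit α) := {l | Th (S.strict ∪ S.D) l}

/-- `⟨A, L⟩` is an argument: `A` is a set of (ground instances of) defeasible
rules from `Δ` and `A ∪ Π` derives `L`. -/
def IsArgument (S : Spec α) (A : Set (Rule α)) (L : Lit α) : Prop :=
  A ⊆ S.D ∧ Th (A ∪ S.strict) L

/-- `H` is a simplified activation set for `⟨A, L⟩`:  `L ∈ 𝔗_{H ∪ A ∪ Π^G}`. -/
def SAct (S : Spec α) (A : Set (Rule α)) (L : Lit α) (H : Set (Lit α)) : Prop :=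
  Th (litRules H ∪ A ∪ S.G) L

/-- `H` is an activation set for `⟨A, L⟩`:
`L ∈ 𝔗_{𝔏 ∪ Π}` for some `𝔏 ⊆ 𝔗_{H ∪ A ∪ Π^G}`. -/
def Act (S : Spec α) (A : Set (Rule α)) (L : Lit α) (H : Set (Lit α)) : Prop :=
  ∃ Ls : Set (Lit α), Ls ⊆ {l | Th (litRules H ∪ A ∪ S.G) l} ∧
    Th (litRules Ls ∪ S.strict) L

/-- `H` is a minimal simplified activation set for `⟨A, L⟩`. -/
def MinSAct (S : Spec α) (A : Set (Rule α)) (L : Lit α) (H : Set (Lit α)) : Prop :=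
  S.SAct A L H ∧ ∀ H' ⊂ H, ¬ S.SAct A L H'

/-- `H` is a minimal activation set for `⟨A, L⟩`. -/
def MinAct (S : Spec α) (A : Set (Rule α)) (L : Lit α) (H : Set (Lit α)) : Prop :=
  S.Act A L H ∧ ∀ H' ⊂ H, ¬ S.Act A L H'

/-- Poole's original specificity relation `≲P1`. -/
def leP1 (S : Spec α) (X Y : Set (Rule α) × Lit α) : Prop :=
  S.IsArgument X.1 X.2 ∧ S.IsArgument Y.1 Y.2 ∧
    ∀ H ⊆ S.ThAll, S.SAct X.1 X.2 H → ¬ S.SAct Y.1 X.2 H → S.SAct Y.1 Y.2 H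

/-- The standard version `≲P2` of Poole's specificity. -/
def leP2 (S : Spec α) (X Y : Set (Rule α) × Lit α) : Prop :=
  S.IsArgument X.1 X.2 ∧ S.IsArgument Y.1 Y.2 ∧
    ∀ H ⊆ S.ThAll, S.SAct X.1 X.2 H → ¬ S.SAct ∅ X.2 H → S.SAct Y.1 Y.2 H

/-- The rather unflawed version `≲P3` of Poole's specificity. -/
def leP3 (S : Spec α) (X Y : Set (Rule α) × Lit α) : Prop :=
  S.IsArgument X.1 X.2 ∧ S.IsArgument Y.1 Y.2 ∧
    (Y.2 ∈ S.ThStrict → X.2 ∈ S.ThStrict) ∧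
    ∀ H ⊆ S.ThAll, S.SAct X.1 X.2 H → ¬ S.SAct ∅ X.2 H → S.SAct Y.1 Y.2 H

/-- The corrected specificity relation `≲CP`. -/
def leCP (S : Spec α) (X Y : Set (Rule α) × Lit α) : Prop :=
  S.IsArgument X.1 X.2 ∧ S.IsArgument Y.1 Y.2 ∧
    (X.2 ∈ S.ThStrict ∨
      (Y.2 ∉ S.ThStrict ∧
        ∀ H ⊆ S.ThStrict, S.Act X.1 X.2 H → S.Act Y.1 Y.2 H))

/-- `<P1 := ≲P1 \ ≳P1`. -/
def ltP1 (S : Spec α) (X Y : Set (Rule α) × Lit α) : Prop := S.leP1 X Y ∧ ¬ S.leP1 Y X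
/-- `<P2 := ≲P2 \ ≳P2`. -/
def ltP2 (S : Spec α) (X Y : Set (Rule α) × Lit α) : Prop := S.leP2 X Y ∧ ¬ S.leP2 Y X
/-- `<P3 := ≲P3 \ ≳P3`. -/
def ltP3 (S : Spec α) (X Y : Set (Rule α) × Lit α) : Prop := S.leP3 X Y ∧ ¬ S.leP3 Y X
/-- `<CP := ≲CP \ ≳CP`. -/
def ltCP (S : Spec α) (X Y : Set (Rule α) × Lit α) : Prop := S.leCP X Y ∧ ¬ S.leCP Y X

/-- `Π^{<2}`: rules of `Π` with at most one body literal. -/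
def strictLt2 (S : Spec α) : Set (Rule α) := {r ∈ S.strict | r.body.card ≤ 1}

/-- `Π^{≥2}`: rules of `Π` with at least two body literals. -/
def strictGe2 (S : Spec α) : Set (Rule α) := {r ∈ S.strict | 2 ≤ r.body.card}

/-- Condition 1 of Theorem 16. -/
def Cond1 (S : Spec α) : Prop :=
  ∀ H ⊆ S.ThStrict, ∀ A ⊆ S.D,
    {l | Th (litRules {l | Th (litRules H ∪ A ∪ S.G) l} ∪ S.strict) l} ⊆
      {l | Th (litRules H ∪ A ∪ S.G) l} ∪ S.ThStrict

/-- Condition 2 of Theorem 16. -/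
def Cond2 (S : Spec α) : Prop :=
  ∀ r ∈ S.strictGe2, r.head ∉ {l | Th S.strictLt2 l} →
    ∀ l ∈ r.body, l ∉ {l | Th S.strictLt2 l}

/-- Condition 3 of Theorem 16. -/
def Cond3 (S : Spec α) : Prop :=
  ∀ r ∈ S.strictGe2, ∀ l ∈ r.body, l ∉ S.ThStrict

/-- Condition 4 of Theorem 16. -/
def Cond4 (S : Spec α) : Prop := S.strictGe2 = ∅

end Spec

/-- Atoms of Poole's Example 6. -/
inductive Atom6 : Type where
  | a | b | c | d | e | f | g1 | g2
  deriving DecidableEq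

open Lit Atom6 in
/-- `A1 = {¬c ⤙ a, ¬f ⤙ d}`. -/
def ex6A1 : Set (Rule Atom6) := {⟨neg c, {pos a}⟩, ⟨neg f, {pos d}⟩}

open Lit Atom6 in
/-- `A2 = {b ⤙ a, c ⤙ b, e ⤙ d, f ⤙ e}`. -/
def ex6A2 : Set (Rule Atom6) :=
  {⟨pos b, {pos a}⟩, ⟨pos c, {pos b}⟩, ⟨pos e, {pos d}⟩, ⟨pos f, {pos e}⟩}

open Lit Atom6 in
/-- The specification of Poole's Example 6. -/
def ex6 : Spec Atom6 where
  F := {pos a, pos d}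
  G := {⟨pos g1, {neg c, neg f}⟩, ⟨pos g2, {pos c, pos f}⟩}
  D := ex6A1 ∪ ex6A2

theorem Th.iff_exists_rule {α : Type} {P : Set (Rule α)} {l : Lit α} :
    Th P l ↔ ∃ r ∈ P, r.head = l ∧ ∀ m ∈ r.body, Th P m := by
  constructor
  · rintro ⟨r, hr, ih⟩
    exact ⟨r, hr, rfl, ih⟩
  · rintro ⟨r, hr, rfl, ih⟩
    exact .step r hr ih

theorem Th.litRules_union_iff {α : Type} {H : Set (Lit α)} {P : Set (Rule α)} {l : Lit α} :
    Th (litRules H ∪ P) l ↔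
      l ∈ H ∨ ∃ r ∈ P, r.head = l ∧ ∀ m ∈ r.body, Th (litRules H ∪ P) m := by
  rw [Th.iff_exists_rule]
  constructor
  · rintro ⟨r, ⟨hr, -⟩ | hr, rfl, ih⟩
    · exact .inl hr
    · exact .inr ⟨r, hr, rfl, ih⟩
  · rintro (hl | ⟨r, hr, h, ih⟩)
    · exact ⟨⟨l, ∅⟩, .inl ⟨hl, rfl⟩, rfl, by simp⟩
    · exact ⟨r, .inr hr, h, ih⟩

theorem Th.mono {α : Type} {P Q : Set (Rule α)} (hPQ : P ⊆ Q) {l : Lit α} (h : Th P l) :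
    Th Q l := by
  induction h with
  | step r hr _ ih => exact .step r (hPQ hr) ih

namespace Spec

variable {α : Type} {S : Spec α} {A : Set (Rule α)} {L : Lit α} {H : Set (Lit α)}

theorem sAct_iff :
    S.SAct A L H ↔ L ∈ H ∨ ∃ r ∈ A ∪ S.G, r.head = L ∧ ∀ m ∈ r.body, S.SAct A m H := by
  unfold SAct
  rw [Set.union_assoc]
  exact Th.litRules_union_iff

theorem th_union_strict_iff : Th (A ∪ S.strict) L ↔ S.SAct A L S.F := by
  rw [SAct, strict, Set.union_left_comm, Set.union_assoc]

theorem mem_thStrict_iff : L ∈ S.ThStrict ↔ S.SAct ∅ L S.F := by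
  rw [← th_union_strict_iff, Set.empty_union]; rfl

theorem act_iff : S.Act A L H ↔ S.SAct ∅ L ({l | S.SAct A l H} ∪ S.F) := by
  have key : ∀ Ls : Set (Lit α),
      litRules Ls ∪ S.strict = litRules (Ls ∪ S.F) ∪ ∅ ∪ S.G := by
    intro Ls
    ext r
    simp only [strict, litRules, Set.mem_union, Set.mem_ofPred_eq, Set.mem_empty_iff_false]
    tauto
  constructor
  · rintro ⟨Ls, hLs, h⟩
    rw [key] at h
    refine Th.mono ?_ h
    rintro r ((⟨hr | hr, hb⟩ | hr) | hr)
    · exact .inl (.inl ⟨.inl (hLs hr), hb⟩)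
    · exact .inl (.inl ⟨.inr hr, hb⟩)
    · exact hr.elim
    · exact .inr hr
  · intro h
    exact ⟨_, subset_rfl, by rw [key]; exact h⟩

end Spec

namespace Ex6

open Lit Atom6 Spec

theorem sAct_empty_g1 {H : Set (Lit Atom6)} :
    ex6.SAct ∅ (pos g1) H ↔ pos g1 ∈ H ∨ (neg c ∈ H ∧ neg f ∈ H) := by
  have hc : ex6.SAct ∅ (neg c) H ↔ neg c ∈ H := by rw [sAct_iff]; simp [ex6]
  have hf : ex6.SAct ∅ (neg f) H ↔ neg f ∈ H := by rw [sAct_iff]; simp [ex6]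
  rw [sAct_iff]; simp [← hc, ← hf, ex6]

theorem sAct_empty_g2 {H : Set (Lit Atom6)} :
    ex6.SAct ∅ (pos g2) H ↔ pos g2 ∈ H ∨ (pos c ∈ H ∧ pos f ∈ H) := by
  have hc : ex6.SAct ∅ (pos c) H ↔ pos c ∈ H := by rw [sAct_iff]; simp [ex6]
  have hf : ex6.SAct ∅ (pos f) H ↔ pos f ∈ H := by rw [sAct_iff]; simp [ex6]
  rw [sAct_iff]; simp [← hc, ← hf, ex6]

theorem sAct_A1_neg_c {H : Set (Lit Atom6)} :
    ex6.SAct ex6A1 (neg c) H ↔ neg c ∈ H ∨ pos a ∈ H := by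
  have ha : ex6.SAct ex6A1 (pos a) H ↔ pos a ∈ H := by rw [sAct_iff]; simp [ex6, ex6A1]
  rw [sAct_iff]; simp [← ha, ex6, ex6A1]

theorem sAct_A1_neg_f {H : Set (Lit Atom6)} :
    ex6.SAct ex6A1 (neg f) H ↔ neg f ∈ H ∨ pos d ∈ H := by
  have hd : ex6.SAct ex6A1 (pos d) H ↔ pos d ∈ H := by rw [sAct_iff]; simp [ex6, ex6A1]
  rw [sAct_iff]; simp [← hd, ex6, ex6A1]

theorem sAct_A1_g1 {H : Set (Lit Atom6)} :
    ex6.SAct ex6A1 (pos g1) H ↔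
      pos g1 ∈ H ∨ ((neg c ∈ H ∨ pos a ∈ H) ∧ (neg f ∈ H ∨ pos d ∈ H)) := by
  rw [sAct_iff]; simp [← sAct_A1_neg_c, ← sAct_A1_neg_f, ex6, ex6A1]

theorem sAct_A2_c {H : Set (Lit Atom6)} :
    ex6.SAct ex6A2 (pos c) H ↔ pos c ∈ H ∨ pos b ∈ H ∨ pos a ∈ H := by
  have ha : ex6.SAct ex6A2 (pos a) H ↔ pos a ∈ H := by rw [sAct_iff]; simp [ex6, ex6A2]
  have hb : ex6.SAct ex6A2 (pos b) H ↔ pos b ∈ H ∨ pos a ∈ H := by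
    rw [sAct_iff]; simp [← ha, ex6, ex6A2]
  rw [sAct_iff]; simp [← hb, ex6, ex6A2]

theorem sAct_A2_f {H : Set (Lit Atom6)} :
    ex6.SAct ex6A2 (pos f) H ↔ pos f ∈ H ∨ pos e ∈ H ∨ pos d ∈ H := by
  have hd : ex6.SAct ex6A2 (pos d) H ↔ pos d ∈ H := by rw [sAct_iff]; simp [ex6, ex6A2]
  have he : ex6.SAct ex6A2 (pos e) H ↔ pos e ∈ H ∨ pos d ∈ H := by
    rw [sAct_iff]; simp [← hd, ex6, ex6A2]
  rw [sAct_iff]; simp [← he, ex6, ex6A2]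

theorem sAct_A2_g2 {H : Set (Lit Atom6)} :
    ex6.SAct ex6A2 (pos g2) H ↔ pos g2 ∈ H ∨
      ((pos c ∈ H ∨ pos b ∈ H ∨ pos a ∈ H) ∧ (pos f ∈ H ∨ pos e ∈ H ∨ pos d ∈ H)) := by
  rw [sAct_iff]; simp [← sAct_A2_c, ← sAct_A2_f, ex6, ex6A2]

theorem mem_F {l : Lit Atom6} : l ∈ ex6.F ↔ l = pos a ∨ l = pos d := Iff.rfl

theorem thStrict_subset {l : Lit Atom6} (h : l ∈ ex6.ThStrict) : l = pos a ∨ l = pos d := by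
  have h1 : ¬ ex6.SAct ∅ (pos g1) ex6.F := by simp [sAct_empty_g1, mem_F]
  have h2 : ¬ ex6.SAct ∅ (pos g2) ex6.F := by simp [sAct_empty_g2, mem_F]
  rw [mem_thStrict_iff] at h
  obtain hF | ⟨r, hr | rfl | rfl, rfl, -⟩ := sAct_iff.1 h
  · exact hF
  · exact hr.elim
  · exact (h1 h).elim
  · exact (h2 h).elim

theorem isArgument_A1 : ex6.IsArgument ex6A1 (pos g1) :=
  ⟨Set.subset_union_left, by simp [th_union_strict_iff, sAct_A1_g1, mem_F]⟩

theorem isArgument_A2 : ex6.IsArgument ex6A2 (pos g2) :=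
  ⟨Set.subset_union_right, by simp [th_union_strict_iff, sAct_A2_g2, mem_F]⟩

theorem act_A1_iff {H : Set (Lit Atom6)} (hH : H ⊆ ex6.ThStrict) :
    ex6.Act ex6A1 (pos g1) H ↔ pos a ∈ H ∧ pos d ∈ H := by
  have h : ∀ l ∈ H, l = pos a ∨ l = pos d := fun l hl => thStrict_subset (hH hl)
  have h1 := h (pos g1)
  have h2 := h (neg c)
  have h3 := h (neg f)
  simp only [reduceCtorEq, pos.injEq, or_self, imp_false] at h1 h2 h3
  simp [act_iff, sAct_empty_g1, mem_F, sAct_A1_neg_c, sAct_A1_neg_f, sAct_A1_g1, h1, h2, h3]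

theorem act_A2_iff {H : Set (Lit Atom6)} (hH : H ⊆ ex6.ThStrict) :
    ex6.Act ex6A2 (pos g2) H ↔ pos a ∈ H ∧ pos d ∈ H := by
  have h : ∀ l ∈ H, l = pos a ∨ l = pos d := fun l hl => thStrict_subset (hH hl)
  have h1 := h (pos g2)
  have h2 := h (pos c)
  have h3 := h (pos f)
  have h4 := h (pos b)
  have h5 := h (pos e)
  simp only [reduceCtorEq, pos.injEq, or_self, imp_false] at h1 h2 h3 h4 h5
  simp [act_iff, sAct_empty_g2, mem_F, sAct_A2_c, sAct_A2_f, sAct_A2_g2, h1, h2, h3, h4, h5]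

theorem mem_thAll_of_rule {l m : Lit Atom6} (hr : ⟨l, {m}⟩ ∈ ex6.D) (hm : m ∈ ex6.F) :
    l ∈ ex6.ThAll := by
  refine Th.step ⟨l, {m}⟩ (.inr hr) fun k hk => ?_
  rw [Finset.mem_singleton.1 hk]
  exact Th.step ⟨m, ∅⟩ (.inl (.inl ⟨hm, rfl⟩)) (by simp)

theorem mem_thAll_of_mem_F {l : Lit Atom6} (hl : l ∈ ex6.F) : l ∈ ex6.ThAll :=
  Th.step ⟨l, ∅⟩ (.inl (.inl ⟨hl, rfl⟩)) (by simp)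

end Ex6

/-- Poole's Example 6: `⟨A1,g1⟩ ≈CP ⟨A2,g2⟩`, but the two arguments are
incomparable w.r.t. `≲P3`. -/
theorem example6_conjunction :
    ex6.leCP (ex6A1, Lit.pos Atom6.g1) (ex6A2, Lit.pos Atom6.g2) ∧
    ex6.leCP (ex6A2, Lit.pos Atom6.g2) (ex6A1, Lit.pos Atom6.g1) ∧
    ¬ ex6.leP3 (ex6A1, Lit.pos Atom6.g1) (ex6A2, Lit.pos Atom6.g2) ∧
    ¬ ex6.leP3 (ex6A2, Lit.pos Atom6.g2) (ex6A1, Lit.pos Atom6.g1) := by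
  open Lit Atom6 Ex6 in
  refine ⟨⟨isArgument_A1, isArgument_A2, .inr ⟨fun h => ?_, fun H hH h => ?_⟩⟩,
    ⟨isArgument_A2, isArgument_A1, .inr ⟨fun h => ?_, fun H hH h => ?_⟩⟩,
    fun ⟨_, _, _, h⟩ => ?_, fun ⟨_, _, _, h⟩ => ?_⟩
  · simpa using thStrict_subset h
  · exact (act_A2_iff hH).2 ((act_A1_iff hH).1 h)
  · simpa using thStrict_subset h
  · exact (act_A1_iff hH).2 ((act_A2_iff hH).1 h)
  · have hsub : ({neg c, pos d} : Set (Lit Atom6)) ⊆ ex6.ThAll := by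
      rintro l (rfl | rfl)
      · exact mem_thAll_of_rule (m := pos a) (by simp [ex6, ex6A1]) (by simp [mem_F])
      · exact mem_thAll_of_mem_F (by simp [mem_F])
    have := h _ hsub (by simp [sAct_A1_g1]) (by simp [sAct_empty_g1])
    simp [sAct_A2_g2] at this
  · have hsub : ({pos b, pos e} : Set (Lit Atom6)) ⊆ ex6.ThAll := by
      rintro l (rfl | rfl)
      · exact mem_thAll_of_rule (m := pos a) (by simp [ex6, ex6A2]) (by simp [mem_F])
      · exact mem_thAll_of_rule (m := pos d) (by simp [ex6, ex6A2]) (by simp [mem_F])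
    have := h _ hsub (by simp [sAct_A2_g2]) (by simp [sAct_empty_g2])
    simp [sAct_A1_g1] at this
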